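/- arXiv:2502.06500 — 2 statements merged into one kernel-verified Lean document; each statement's English description precedes it below -/
import Mathlib

section
/- Existence of a Schur weight: let d ≥ 1 and S : ℤ^d × ℤ^d → ℝ satisfy S_{i,j} > 0 for all i, j and c := sup_{i∈ℤ^d} Σ_{j∈ℤ^d} S_{i,j} < ∞ (every row is summable, with uniformly bounded sums). Then there exists γ : ℤ^d → ℝ with γ_i > 0 for all i, Σ_{i∈ℤ^d} γ_i = 1, and, for every i ∈ ℤ^d, the sum Σ_{j∈ℤ^d} γ_j S_{j,i} converges and satisfies Σ_{j∈ℤ^d} γ_j S_{j,i} ≤ (1+c)·γ_i. -/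
open scoped ENNReal in
/-- A positive kernel whose row sums are bounded by some `r < 1` has a positive
subinvariant probability weight. -/
theorem exists_subinvariant_weight {ι : Type*} [Nonempty ι] (K : ι → ι → ℝ≥0∞) (r : ℝ≥0∞)
    (hr : r < 1) (hpos : ∀ i j, 0 < K i j) (hrow : ∀ i, ∑' j, K i j ≤ r) :
    ∃ G : ι → ℝ≥0∞, (∀ i, 0 < G i) ∧ ∑' i, G i = 1 ∧ ∀ i, ∑' j, G j * K j i ≤ G i := by
  classical
  obtain ⟨o⟩ := ‹Nonempty ι›
  let w : ℕ → ι → ℝ≥0∞ := fun n =>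
    Nat.rec (Pi.single o 1) (fun _ v j => ∑' i, v i * K i j) n
  have w_zero : w 0 = Pi.single o 1 := rfl
  have w_succ (n : ℕ) (j : ι) : w (n + 1) j = ∑' i, w n i * K i j := rfl
  have w_mass (n : ℕ) : ∑' j, w n j ≤ r ^ n := by
    induction n with
    | zero => simp [w_zero, tsum_pi_single]
    | succ n ih =>
      calc ∑' j, w (n + 1) j = ∑' i, w n i * ∑' j, K i j := by
            simp_rw [w_succ, ← ENNReal.tsum_mul_left]
            exact ENNReal.tsum_comm
        _ ≤ ∑' i, w n i * r := by gcongr with i; exact hrow i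
        _ = (∑' i, w n i) * r := ENNReal.tsum_mul_right
        _ ≤ r ^ n * r := by gcongr
        _ = r ^ (n + 1) := (pow_succ r n).symm
  let T : ι → ℝ≥0∞ := fun j => ∑' n, w n j
  have T_pos (j : ι) : 0 < T j := by
    have h : w (0 + 1) j = K o j := by
      rw [w_succ, tsum_eq_single o (by intro i hi; simp [w_zero, hi])]
      simp [w_zero]
    exact (h ▸ hpos o j).trans_le (ENNReal.le_tsum (f := fun n => w n j) 1)
  have T_sub (j : ι) : ∑' i, T i * K i j ≤ T j :=
    calc ∑' i, T i * K i j = ∑' n, w (n + 1) j := by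
          simp_rw [T, w_succ, ← ENNReal.tsum_mul_right]
          exact ENNReal.tsum_comm
      _ ≤ T j := ENNReal.tsum_comp_le_tsum_of_injective (add_left_injective 1) (fun n => w n j)
  have T_top : ∑' j, T j ≠ ⊤ := by
    have h : ∑' j, T j ≤ (1 - r)⁻¹ :=
      calc ∑' j, T j = ∑' n, ∑' j, w n j := ENNReal.tsum_comm
        _ ≤ ∑' n, r ^ n := ENNReal.tsum_le_tsum w_mass
        _ = (1 - r)⁻¹ := ENNReal.tsum_geometric r
    exact ne_top_of_le_ne_top (ENNReal.inv_ne_top.2 (tsub_pos_of_lt hr).ne') h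
  have T_ne : ∑' j, T j ≠ 0 := ((T_pos o).trans_le (ENNReal.le_tsum o)).ne'
  refine ⟨fun i => (∑' j, T j)⁻¹ * T i, fun i => ?_, ?_, fun i => ?_⟩
  · exact ENNReal.mul_pos (ENNReal.inv_ne_zero.2 T_top) (T_pos i).ne'
  · rw [ENNReal.tsum_mul_left, ENNReal.inv_mul_cancel T_ne T_top]
  · simp_rw [mul_assoc, ENNReal.tsum_mul_left]
    gcongr
    exact T_sub i



/-- Existence of a Schur weight: for a positive kernel `S` on `ℤ^d` with summable rows
and uniformly bounded row sums `c = sup_i Σ_j S_{i,j}`, there is a positive probability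
weight `γ` on `ℤ^d` with `Σ_j γ_j S_{j,i} ≤ (1+c)·γ_i` for every `i`. -/
theorem stmt12 (d : ℕ) (hd : 1 ≤ d)
    (S : (Fin d → ℤ) → (Fin d → ℤ) → ℝ)
    (hpos : ∀ i j, 0 < S i j)
    (hrow : ∀ i, Summable (S i))
    (hbdd : BddAbove (Set.range fun i => ∑' j, S i j)) :
    ∃ γ : (Fin d → ℤ) → ℝ, (∀ i, 0 < γ i) ∧ HasSum γ 1 ∧
      ∀ i, Summable (fun j => γ j * S j i) ∧
        ∑' j, γ j * S j i ≤ (1 + ⨆ i, ∑' j, S i j) * γ i := by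
  set c := ⨆ i, ∑' j, S i j with hc
  have hle (i : Fin d → ℤ) : ∑' j, S i j ≤ c := le_ciSup hbdd i
  have c_nonneg : 0 ≤ c := (tsum_nonneg fun j => (hpos 0 j).le).trans (hle 0)
  have c_pos : 0 < 1 + c := by positivity
  have div_pos' (i j : Fin d → ℤ) : 0 < S i j / (1 + c) := div_pos (hpos i j) c_pos
  obtain ⟨G, G_pos, G_sum, G_sub⟩ := exists_subinvariant_weight
    (fun i j => ENNReal.ofReal (S i j / (1 + c))) (ENNReal.ofReal (c / (1 + c)))
    (by rw [ENNReal.ofReal_lt_one, div_lt_one c_pos]; linarith)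
    (fun i j => ENNReal.ofReal_pos.2 (div_pos' i j))
    (fun i => by
      rw [← ENNReal.ofReal_tsum_of_nonneg (fun j => (div_pos' i j).le) ((hrow i).div_const _),
        tsum_div_const]
      gcongr
      exact hle i)
  have G_top (i : Fin d → ℤ) : G i ≠ ⊤ :=
    ne_top_of_le_ne_top ENNReal.one_ne_top (G_sum ▸ ENNReal.le_tsum i)
  refine ⟨fun i => (G i).toReal, fun i => ENNReal.toReal_pos (G_pos i).ne' (G_top i), ?_,
    fun i => ?_⟩
  · have h := ENNReal.hasSum_toReal (f := G) (by simp [G_sum])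
    rwa [← ENNReal.tsum_toReal_eq G_top, G_sum, ENNReal.toReal_one] at h
  · have top := ne_top_of_le_ne_top (G_top i) (G_sub i)
    have h := (ENNReal.summable_toReal top).hasSum.mul_left (1 + c)
    rw [← ENNReal.tsum_toReal_eq (ENNReal.ne_top_of_tsum_ne_top top)] at h
    have heq (j : Fin d → ℤ) :
        (1 + c) * (G j * ENNReal.ofReal (S j i / (1 + c))).toReal = (G j).toReal * S j i := by
      rw [ENNReal.toReal_mul, ENNReal.toReal_ofReal (div_pos' j i).le]
      field_simp
    simp_rw [heq] at h
    refine ⟨h.summable, h.tsum_eq.trans_le ?_⟩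
    gcongr
    exact ENNReal.toReal_mono (G_top i) (G_sub i)
end

section
/- Equivalence of the differential and integral formulations of the Evolution Variational Inequality (EVI): let (X, dist) be a metric space, K ∈ ℝ, and F : X → ℝ ∪ {+∞} a function bounded from below. Let P : [0,∞) → X be a continuous curve with F(P(0)) < ∞ such that t ↦ F(P(t)) is Borel measurable. Then the following are equivalent. (1) P is locally absolutely continuous on (0,∞) (i.e., for every compact [a,b] ⊂ (0,∞) there exists g ∈ L¹([a,b]) with dist(P(s), P(t)) ≤ ∫_s^t g(u) du for all a ≤ s ≤ t ≤ b), and for every R ∈ X, for almost every t ∈ (0,∞), the function u ↦ (1/2)·dist(P(u), R)² is differentiable at t and (1/2)·(d/dt) dist(P(t), R)² + (K/2)·dist(P(t), R)² + F(P(t)) ≤ F(R). (2) For every R ∈ X and all 0 ≤ s < t: ∫_s^t e^{Ku} F(P(u)) du + (1/2) e^{Kt} dist(P(t), R)² − (1/2) e^{Ks} dist(P(s), R)² ≤ ( ∫_s^t e^{Ku} du ) · F(R), where both sides are interpreted in ℝ ∪ {+∞}. -/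
open MeasureTheory Filter Topology
open scoped Classical

/-- The integral `∫_s^t f(u) du` of a function `f : ℝ → ℝ ∪ {+∞}` which is (essentially)
bounded below, interpreted in `ℝ ∪ {+∞} ⊆ EReal`: it is the Bochner integral of the real
part if `f` is a.e. finite and integrable on `(s,t]`, and `+∞` otherwise. -/
noncomputable def erealIntegral (f : ℝ → EReal) (s t : ℝ) : EReal :=
  if (∀ᵐ u ∂(volume.restrict (Set.Ioc s t)), f u ≠ ⊤) ∧
      IntegrableOn (fun u => (f u).toReal) (Set.Ioc s t)
  then (((∫ u in Set.Ioc s t, (f u).toReal) : ℝ) : EReal) else ⊤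

theorem absolutelyContinuousOnInterval_of_dist_le {X Y : Type*} [PseudoMetricSpace X]
    [PseudoMetricSpace Y] {f : ℝ → X} {G : ℝ → Y} {a b : ℝ}
    (hG : AbsolutelyContinuousOnInterval G a b)
    (h : ∀ x ∈ Set.uIcc a b, ∀ y ∈ Set.uIcc a b, dist (f x) (f y) ≤ dist (G x) (G y)) :
    AbsolutelyContinuousOnInterval f a b := by
  rw [absolutelyContinuousOnInterval_iff] at hG ⊢
  intro ε hε
  obtain ⟨δ, hδ, H⟩ := hG ε hε
  refine ⟨δ, hδ, fun E hE hs => lt_of_le_of_lt (Finset.sum_le_sum fun i hi => ?_) (H E hE hs)⟩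
  exact h _ (hE.1 i hi).1 _ (hE.1 i hi).2

theorem HasDerivAt.nonpos_of_eventually_le_right {f : ℝ → ℝ} {f' x : ℝ} (hf : HasDerivAt f f' x)
    (h : ∀ᶠ ε in 𝓝[>] (0 : ℝ), f (x + ε) ≤ f x) : f' ≤ 0 := by
  refine le_of_tendsto hf.tendsto_slope_zero_right ?_
  filter_upwards [h, self_mem_nhdsWithin] with ε h1 h2
  have : 0 < ε := h2
  exact mul_nonpos_of_nonneg_of_nonpos (inv_nonneg.2 this.le) (by linarith)

theorem hasDerivAt_id_mul_of_continuousAt {c : ℝ → ℝ} (hc : ContinuousAt c 0) :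
    HasDerivAt (fun ε => ε * c ε) (c 0) 0 := by
  rw [hasDerivAt_iff_tendsto_slope_zero]
  have h : Tendsto c (𝓝[≠] 0) (𝓝 (c 0)) := hc.tendsto.mono_left nhdsWithin_le_nhds
  refine h.congr' ?_
  filter_upwards [self_mem_nhdsWithin] with t ht
  have : t ≠ 0 := ht
  simp [this]

/-- Integral form of Grönwall's inequality. -/
theorem le_mul_exp_of_sub_le_integral {W : ℝ → ℝ} (hW : Continuous W) {c a b : ℝ}
    (hab : a ≤ b) (h : ∀ x y, a ≤ x → x ≤ y → W y - W x ≤ c * ∫ u in x..y, W u) :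
    W b ≤ W a * Real.exp (c * (b - a)) := by
  have := le_gronwallBound_of_liminf_deriv_right_le (f := W) (f' := fun x => c * W x)
    (δ := W a) (K := c) (ε := 0) (a := a) (b := b) hW.continuousOn ?_ le_rfl (by simp) b
    ⟨hab, le_rfl⟩
  · rwa [gronwallBound_ε0] at this
  · intro x hx r hr
    have hd : HasDerivAt (fun y => c * ∫ u in x..y, W u) (c * W x) x :=
      (intervalIntegral.integral_hasDerivAt_right (hW.intervalIntegrable _ _)
        (hW.stronglyMeasurableAtFilter _ _) hW.continuousAt).const_mul c
    have hs := hd.hasDerivWithinAt (s := Set.Ioi x)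
    rw [hasDerivWithinAt_iff_tendsto_slope' (by simp)] at hs
    have he : ∀ᶠ z in 𝓝[>] x, slope (fun y => c * ∫ u in x..y, W u) x z < r :=
      hs.eventually (gt_mem_nhds hr)
    refine Eventually.frequently ?_
    filter_upwards [he, self_mem_nhdsWithin] with z hz hxz
    have hxz : x < z := hxz
    refine lt_of_le_of_lt ?_ hz
    simp only [slope, intervalIntegral.integral_same, mul_zero, vsub_eq_sub, sub_zero, smul_eq_mul]
    exact mul_le_mul_of_nonneg_left (h x z hx.1 hxz.le) (inv_nonneg.2 (by linarith))

/-- Integrated form of the contraction estimate for a curve satisfying a discrete variational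
inequality against almost all of its own points. -/
theorem halfSqDist_sub_le_integral {X : Type*} [PseudoMetricSpace X] {Q : ℝ → X}
    (hQ : Continuous Q) {φ : ℝ → ℝ} (hφ : ∀ x, 0 ≤ φ x)
    (hint : ∀ a b, IntervalIntegrable φ volume a b) {k : ℝ} {S : Set ℝ} (hS : ∀ᵐ x, x ∈ S)
    (star : ∀ x ∈ S, ∀ s, 0 ≤ s → ∀ ε, 0 < ε →
      (1 - k * ε) * (dist (Q (s + ε)) (Q x) ^ 2 / 2) - dist (Q s) (Q x) ^ 2 / 2 ≤
        ε * Real.exp (k * ε) * φ x - Real.exp (-(k * ε)) * ∫ u in s..(s + ε), φ u)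
    (hk : 0 ≤ k) {h a b : ℝ} (hh : 0 ≤ h) (ha : 0 ≤ a) (hab : a ≤ b) :
    dist (Q b) (Q (b + h)) ^ 2 / 2 - dist (Q a) (Q (a + h)) ^ 2 / 2 ≤
      2 * k * ∫ s in a..b, dist (Q s) (Q (s + h)) ^ 2 / 2 := by
  set W : ℝ → ℝ := fun s => dist (Q s) (Q (s + h)) ^ 2 / 2 with hWdef
  have hW : Continuous W := by fun_prop
  set Φ : ℝ → ℝ := fun x => ∫ u in (0:ℝ)..x, φ u with hΦdef
  have hΦ : Continuous Φ := intervalIntegral.continuous_primitive hint 0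
  have hΦsub : ∀ x y, ∫ u in x..y, φ u = Φ y - Φ x := fun x y =>
    (intervalIntegral.integral_interval_sub_left (hint 0 y) (hint 0 x)).symm
  have prim : ∀ g : ℝ → ℝ, Continuous g → ∃ J : ℝ → ℝ, (∀ x, HasDerivAt J (g x) x) ∧
      ∀ x y, ∫ u in x..y, g u = J y - J x := fun g hg =>
    ⟨fun x => ∫ u in (0:ℝ)..x, g u, fun x => intervalIntegral.integral_hasDerivAt_right
      (hg.intervalIntegrable _ _) (hg.stronglyMeasurableAtFilter _ _) hg.continuousAt, fun x y =>
      (intervalIntegral.integral_interval_sub_left (hg.intervalIntegrable 0 y)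
        (hg.intervalIntegrable 0 x)).symm⟩
  obtain ⟨J, hJ, hJi⟩ := prim W hW
  obtain ⟨Ψ, hΨ, hΨi⟩ := prim Φ hΦ
  have shift : ∀ (J : ℝ → ℝ) (g : ℝ → ℝ), (∀ x, HasDerivAt J (g x) x) → ∀ x,
      HasDerivAt (fun ε => J (x + ε)) (g x) 0 := fun J g hJ x =>
    HasDerivAt.comp_const_add x 0 (by simpa using hJ x)
  let f : ℝ → ℝ := fun ε => (1 - k * ε) ^ 2 * (J (b + ε) - J (a + ε)) - (J b - J a)
    - ε * (Real.exp (k * ε) * ((Φ (b + h) - Φ (a + h)) + (Φ (b + ε) - Φ (a + ε))))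
    + (Real.exp (-(k * ε)) * (1 - k * ε)) * (((Ψ (b + ε) - Ψ (a + ε)) - (Ψ b - Ψ a))
      + ((Ψ (b + h + ε) - Ψ (a + h + ε)) - (Ψ (b + h) - Ψ (a + h))))
  have hf : HasDerivAt f (W b - W a - 2 * k * (J b - J a)) 0 := by
    have hq : HasDerivAt (fun ε : ℝ => (1 - k * ε) ^ 2) (-(2 * k)) 0 := by
      have : HasDerivAt (fun ε : ℝ => 1 - k * ε) (-k) 0 := by
        simpa using ((hasDerivAt_id (0:ℝ)).const_mul k).const_sub 1
      simpa using this.fun_pow 2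
    have hp : HasDerivAt (fun ε : ℝ => Real.exp (-(k * ε)) * (1 - k * ε)) (-k + -k) 0 := by
      have h1 : HasDerivAt (fun ε : ℝ => 1 - k * ε) (-k) 0 := by
        simpa using ((hasDerivAt_id (0:ℝ)).const_mul k).const_sub 1
      have h2 : HasDerivAt (fun ε : ℝ => Real.exp (-(k * ε))) (-k) 0 := by
        simpa using (((hasDerivAt_id (0:ℝ)).const_mul k).neg).exp
      simpa using h2.fun_mul h1
    have h1 := (hq.mul ((shift J W hJ b).sub (shift J W hJ a))).sub_const (J b - J a)
    have h2 := hasDerivAt_id_mul_of_continuousAt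
      (c := fun ε => Real.exp (k * ε) * ((Φ (b + h) - Φ (a + h)) + (Φ (b + ε) - Φ (a + ε))))
      (by fun_prop)
    have h3 := hp.mul ((((shift Ψ Φ hΨ b).sub (shift Ψ Φ hΨ a)).sub_const (Ψ b - Ψ a)).add
      (((shift Ψ Φ hΨ (b + h)).sub (shift Ψ Φ hΨ (a + h))).sub_const (Ψ (b + h) - Ψ (a + h))))
    refine ((h1.sub h2).add h3).congr_deriv ?_
    simp
    ring
  have key := hf.nonpos_of_eventually_le_right ?_
  · rw [hJi]
    change W b - W a ≤ _
    linarith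
  have hsmall : ∀ᶠ ε in 𝓝[>] (0:ℝ), k * ε < 1 := by
    have : Tendsto (fun ε : ℝ => k * ε) (𝓝[>] 0) (𝓝 (k * 0)) :=
      ((continuous_const.mul continuous_id).tendsto 0).mono_left nhdsWithin_le_nhds
    exact this.eventually (gt_mem_nhds (by simp))
  filter_upwards [hsmall, self_mem_nhdsWithin] with ε hε1 hε0
  have hε0 : 0 < ε := hε0
  have trans_ae : ∀ c : ℝ, ∀ᵐ s, s + c ∈ S := fun c =>
    (measurePreserving_add_right volume c).quasiMeasurePreserving.ae hS
  have hpt : ∀ᵐ s, s ∈ Set.Icc a b → (1 - k * ε) ^ 2 * W (s + ε) - W s ≤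
      ε * Real.exp (k * ε) * (φ (s + h) + φ (s + ε)) - (Real.exp (-(k * ε)) * (1 - k * ε)) *
        ((Φ (s + ε) - Φ s) + (Φ (s + h + ε) - Φ (s + h))) := by
    filter_upwards [trans_ae h, trans_ae ε] with s h1 h2 hs
    have m1 := star _ h1 s (ha.trans hs.1) ε hε0
    have m2 := star _ h2 (s + h) (by linarith [ha.trans hs.1]) ε hε0
    rw [hΦsub] at m1 m2
    have mono : ∀ x, 0 ≤ Φ (x + ε) - Φ x := fun x => by
      rw [← hΦsub]; exact intervalIntegral.integral_nonneg (by linarith) fun u _ => hφ u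
    have e1 : dist (Q (s + h)) (Q (s + ε)) = dist (Q (s + ε)) (Q (s + h)) := dist_comm _ _
    have e2 : dist (Q (s + h + ε)) (Q (s + ε)) = dist (Q (s + ε)) (Q (s + ε + h)) := by
      rw [dist_comm, add_right_comm]
    rw [e1, e2] at m2
    have hq : 0 ≤ 1 - k * ε := by linarith
    have m3 := mul_le_mul_of_nonneg_left m2 hq
    simp only [hWdef]
    have p1 : 0 ≤ k * ε * (ε * Real.exp (k * ε) * φ (s + ε)) := by
      have := hφ (s + ε); positivity
    have p2 : 0 ≤ k * ε * (Real.exp (-(k * ε)) * (Φ (s + ε) - Φ s)) := by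
      have := mono s; positivity
    nlinarith
  have iW : ∀ c, IntervalIntegrable (fun s => W (s + c)) volume a b := fun c =>
    (by fun_prop : Continuous fun s => W (s + c)).intervalIntegrable _ _
  have iΦ : ∀ c, IntervalIntegrable (fun s => Φ (s + c)) volume a b := fun c =>
    (by fun_prop : Continuous fun s => Φ (s + c)).intervalIntegrable _ _
  have iφ : ∀ c, IntervalIntegrable (fun s => φ (s + c)) volume a b := fun c => by
    simpa using (hint (a + c) (b + c)).comp_add_right c
  have iW0 : IntervalIntegrable W volume a b := by simpa using iW 0
  have iΦ0 : IntervalIntegrable Φ volume a b := by simpa using iΦ 0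
  have iΦ2 : IntervalIntegrable (fun s => Φ (s + h + ε)) volume a b := by
    simpa [add_assoc] using iΦ (h + ε)
  have hI := intervalIntegral.integral_mono_ae_restrict hab
    (((iW ε).const_mul ((1 - k * ε) ^ 2)).sub iW0)
    ((((iφ h).add (iφ ε)).const_mul (ε * Real.exp (k * ε))).sub
      ((((iΦ ε).sub iΦ0).add (iΦ2.sub (iΦ h))).const_mul (Real.exp (-(k * ε)) * (1 - k * ε))))
    ((ae_restrict_iff' measurableSet_Icc).2 hpt)
  rw [intervalIntegral.integral_sub ((iW ε).const_mul _) iW0,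
    intervalIntegral.integral_sub (((iφ h).add (iφ ε)).const_mul _)
      ((((iΦ ε).sub iΦ0).add (iΦ2.sub (iΦ h))).const_mul _),
    intervalIntegral.integral_const_mul, intervalIntegral.integral_const_mul,
    intervalIntegral.integral_const_mul, intervalIntegral.integral_add (iφ h) (iφ ε),
    intervalIntegral.integral_add ((iΦ ε).sub iΦ0) (iΦ2.sub (iΦ h)),
    intervalIntegral.integral_sub (iΦ ε) iΦ0, intervalIntegral.integral_sub iΦ2 (iΦ h)] at hI
  have e3 : ∫ s in a..b, Φ (s + h + ε) = Ψ (b + h + ε) - Ψ (a + h + ε) := by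
    simp_rw [add_assoc _ h ε]
    rw [intervalIntegral.integral_comp_add_right Φ, hΨi]
  rw [e3, intervalIntegral.integral_comp_add_right W, intervalIntegral.integral_comp_add_right φ,
    intervalIntegral.integral_comp_add_right φ, intervalIntegral.integral_comp_add_right Φ,
    intervalIntegral.integral_comp_add_right Φ, hJi, hJi, hΦsub, hΦsub, hΨi, hΨi, hΨi] at hI
  simp only [f]
  simp only [zero_add, add_zero, mul_zero, zero_mul, sub_self]
  linarith

/-- A curve satisfying a discrete variational inequality against almost all of its own points is
locally Lipschitz away from the initial time. -/
theorem exists_forall_dist_le_mul_sub {X : Type*} [PseudoMetricSpace X] {Q : ℝ → X}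
    (hQ : Continuous Q) {φ : ℝ → ℝ} (hφ : ∀ x, 0 ≤ φ x)
    (hint : ∀ a b, IntervalIntegrable φ volume a b) {k : ℝ} {S : Set ℝ} (hS : ∀ᵐ x, x ∈ S)
    (star : ∀ x ∈ S, ∀ s, 0 ≤ s → ∀ ε, 0 < ε →
      (1 - k * ε) * (dist (Q (s + ε)) (Q x) ^ 2 / 2) - dist (Q s) (Q x) ^ 2 / 2 ≤
        ε * Real.exp (k * ε) * φ x - Real.exp (-(k * ε)) * ∫ u in s..(s + ε), φ u)
    (hk : 0 ≤ k) {a b : ℝ} (ha : 0 < a) :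
    ∃ C : ℝ, ∀ s t : ℝ, a ≤ s → s ≤ t → t ≤ b → dist (Q s) (Q t) ≤ C * (t - s) := by
  set Φ : ℝ → ℝ := fun x => ∫ u in (0:ℝ)..x, φ u with hΦdef
  have hΦ : Continuous Φ := intervalIntegral.continuous_primitive hint 0
  have hΦsub : ∀ x y, ∫ u in x..y, φ u = Φ y - Φ x := fun x y =>
    (intervalIntegral.integral_interval_sub_left (hint 0 y) (hint 0 x)).symm
  have hΦmono : Monotone Φ := fun x y hxy => by
    have : 0 ≤ ∫ u in x..y, φ u := intervalIntegral.integral_nonneg hxy fun u _ => hφ u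
    rw [hΦsub] at this
    linarith
  obtain ⟨a₀, ha₀, hd⟩ : ∃ a₀ ∈ Set.Ioo 0 a, HasDerivAt Φ (φ a₀) a₀ := by
    have h1 := (hint 0 a).ae_hasDerivAt_integral
    have h2 : ∃ᵐ x ∂(volume : Measure ℝ), x ∈ Set.Ioo 0 a := by
      rw [frequently_ae_mem_iff]
      simp [ha]
    obtain ⟨x, hx, hx'⟩ := (h2.and_eventually h1).exists
    refine ⟨x, hx, hx' ?_ 0 (by simp)⟩
    rw [Set.uIcc_of_le ha.le]
    exact Set.Ioo_subset_Icc_self hx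
  set D := φ a₀ + 1 with hDdef
  have hD : 0 ≤ D := by linarith [hφ a₀]
  have hsmall : ∀ᶠ h in 𝓝[>] (0:ℝ), Φ (a₀ + h) - Φ a₀ ≤ D * h := by
    have hlt := hd.tendsto_slope_zero_right.eventually (gt_mem_nhds (lt_add_one (φ a₀)))
    filter_upwards [hlt, self_mem_nhdsWithin] with h h1 h2
    have h2 : 0 < h := h2
    rw [smul_eq_mul, inv_mul_lt_iff₀ h2] at h1
    linarith
  have hkh : ∀ᶠ h in 𝓝[>] (0:ℝ), k * h < 1 / 2 := by
    have : Tendsto (fun h : ℝ => k * h) (𝓝[>] 0) (𝓝 (k * 0)) :=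
      ((continuous_const.mul continuous_id).tendsto 0).mono_left nhdsWithin_le_nhds
    exact this.eventually (gt_mem_nhds (by simp))
  obtain ⟨h₀, hh₀, H⟩ := (mem_nhdsGT_iff_exists_Ioc_subset).1 (hsmall.and hkh)
  have hh₀ : 0 < h₀ := hh₀
  set W : ℝ → ℝ → ℝ := fun h s => dist (Q s) (Q (s + h)) ^ 2 / 2 with hWdef
  have hW : ∀ h, Continuous (W h) := fun h => by fun_prop
  have hΔ : 0 ≤ Φ a - Φ a₀ := by linarith [hΦmono ha₀.2.le]
  obtain ⟨C₁, hC₁⟩ : ∃ C₁, C₁ = 2 * (3 * k * (Φ a - Φ a₀) + D) := ⟨_, rfl⟩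
  have hC₁0 : 0 ≤ C₁ := by rw [hC₁]; positivity
  have hWint : ∀ h ∈ Set.Ioc 0 h₀, ∫ s in a₀..a, W h s ≤ C₁ * h ^ 2 := by
    intro h hh
    obtain ⟨h1, h2⟩ := H hh
    have hpt : ∀ᵐ s, s ∈ Set.Icc a₀ a → (1 - k * h) * W h s ≤
        h * Real.exp (k * h) * φ s - Real.exp (-(k * h)) * (Φ (s + h) - Φ s) := by
      filter_upwards [hS] with s hs hsI
      have := star s hs s (ha₀.1.le.trans hsI.1) h hh.1
      rw [hΦsub, dist_self, dist_comm] at this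
      simpa [hWdef] using this
    have iΦ : IntervalIntegrable Φ volume a₀ a := hΦ.intervalIntegrable _ _
    have iΦh : IntervalIntegrable (fun s => Φ (s + h)) volume a₀ a :=
      (by fun_prop : Continuous fun s => Φ (s + h)).intervalIntegrable _ _
    have hI := intervalIntegral.integral_mono_ae_restrict ha₀.2.le
      (((hW h).intervalIntegrable _ _).const_mul (1 - k * h))
      (((hint a₀ a).const_mul (h * Real.exp (k * h))).sub
        ((iΦh.sub iΦ).const_mul (Real.exp (-(k * h)))))
      ((ae_restrict_iff' measurableSet_Icc).2 hpt)
    rw [intervalIntegral.integral_sub ((hint a₀ a).const_mul _) ((iΦh.sub iΦ).const_mul _),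
      intervalIntegral.integral_const_mul, intervalIntegral.integral_const_mul,
      intervalIntegral.integral_const_mul, intervalIntegral.integral_sub iΦh iΦ,
      intervalIntegral.integral_comp_add_right Φ, hΦsub] at hI
    have swap : (∫ s in (a₀ + h)..(a + h), Φ s) - ∫ s in a₀..a, Φ s =
        (∫ s in a..(a + h), Φ s) - ∫ s in a₀..(a₀ + h), Φ s := by
      have e1 := intervalIntegral.integral_add_adjacent_intervals
        (hΦ.intervalIntegrable (μ := volume) a₀ (a₀ + h)) (hΦ.intervalIntegrable (a₀ + h) (a + h))
      have e2 := intervalIntegral.integral_add_adjacent_intervals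
        (hΦ.intervalIntegrable (μ := volume) a₀ a) (hΦ.intervalIntegrable a (a + h))
      linarith
    have up : ∫ s in a₀..(a₀ + h), Φ s ≤ h * (Φ a₀ + D * h) := by
      have := intervalIntegral.integral_mono_on (a := a₀) (b := a₀ + h) (by linarith [hh.1])
        (hΦ.intervalIntegrable (μ := volume) _ _)
        (intervalIntegrable_const (c := Φ a₀ + D * h))
        (fun x hx => by linarith [hΦmono hx.2])
      rwa [intervalIntegral.integral_const, smul_eq_mul, add_sub_cancel_left] at this
    have lo : h * Φ a ≤ ∫ s in a..(a + h), Φ s := by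
      have := intervalIntegral.integral_mono_on (a := a) (b := a + h) (by linarith [hh.1])
        (intervalIntegrable_const (c := Φ a))
        (hΦ.intervalIntegrable (μ := volume) _ _) (fun x hx => hΦmono hx.1)
      simpa using this
    rw [swap] at hI
    have hkh0 : 0 ≤ k * h := mul_nonneg hk hh.1.le
    have ex1 : Real.exp (k * h) ≤ 1 + 2 * (k * h) := by
      have := Real.one_sub_le_exp_neg (k * h)
      have hp : Real.exp (k * h) * Real.exp (-(k * h)) = 1 := by rw [← Real.exp_add]; simp
      nlinarith [Real.exp_pos (k * h)]
    have ex2 : 1 - k * h ≤ Real.exp (-(k * h)) := Real.one_sub_le_exp_neg (k * h)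
    have ex3 : Real.exp (-(k * h)) ≤ 1 := Real.exp_le_one_iff.2 (by linarith)
    have hWn : 0 ≤ ∫ s in a₀..a, W h s :=
      intervalIntegral.integral_nonneg ha₀.2.le fun s _ => by simp only [hWdef]; positivity
    have q1 : (1 / 2) * (∫ s in a₀..a, W h s) ≤ (1 - k * h) * ∫ s in a₀..a, W h s :=
      mul_le_mul_of_nonneg_right (by linarith) hWn
    have q2 : Real.exp (-(k * h)) * (h * (Φ a - Φ a₀) - D * h ^ 2) ≤ Real.exp (-(k * h)) *
        ((∫ s in a..(a + h), Φ s) - ∫ s in a₀..(a₀ + h), Φ s) :=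
      mul_le_mul_of_nonneg_left (by nlinarith) (Real.exp_pos _).le
    have hhD : 0 ≤ h * (Φ a - Φ a₀) := mul_nonneg hh.1.le hΔ
    have q3 : (Real.exp (k * h) - Real.exp (-(k * h))) * (h * (Φ a - Φ a₀)) ≤
        (3 * (k * h)) * (h * (Φ a - Φ a₀)) :=
      mul_le_mul_of_nonneg_right (by linarith) hhD
    have q4 : Real.exp (-(k * h)) * (D * h ^ 2) ≤ 1 * (D * h ^ 2) :=
      mul_le_mul_of_nonneg_right ex3 (by positivity)
    rw [hC₁]
    nlinarith
  obtain ⟨C₂, hC₂⟩ : ∃ C₂, C₂ = Real.exp (2 * k * b) * C₁ / (a - a₀) := ⟨_, rfl⟩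
  have haa : 0 < a - a₀ := sub_pos.2 ha₀.2
  have hC₂0 : 0 ≤ C₂ := by rw [hC₂]; positivity
  have hshort : ∀ h ∈ Set.Ioc 0 h₀, ∀ t, a ≤ t → t ≤ b → W h t ≤ C₂ * h ^ 2 := by
    intro h hh t hat htb
    have hle : ∀ s ∈ Set.Icc a₀ a, W h t ≤ Real.exp (2 * k * b) * W h s := by
      intro s hs
      have := le_mul_exp_of_sub_le_integral (hW h) (c := 2 * k) (hs.2.trans hat)
        fun x y hx hxy => halfSqDist_sub_le_integral hQ hφ hint hS star hk hh.1.le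
          (ha₀.1.le.trans (hs.1.trans hx)) hxy
      refine this.trans ?_
      rw [mul_comm]
      refine mul_le_mul_of_nonneg_right (Real.exp_le_exp.2 ?_) (by simp only [hWdef]; positivity)
      exact mul_le_mul_of_nonneg_left (by linarith [hs.1, ha₀.1]) (by positivity)
    have hI := intervalIntegral.integral_mono_on ha₀.2.le
      (intervalIntegrable_const (μ := volume) (c := W h t))
      (((hW h).intervalIntegrable (μ := volume) _ _).const_mul (Real.exp (2 * k * b))) hle
    rw [intervalIntegral.integral_const_mul, intervalIntegral.integral_const, smul_eq_mul] at hI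
    have h3 := mul_le_mul_of_nonneg_left (hWint h hh) (Real.exp_pos (2 * k * b)).le
    rw [hC₂, div_mul_eq_mul_div, le_div_iff₀ haa]
    linarith
  obtain ⟨M, hM⟩ : ∃ M, ∀ s ∈ Set.Icc a b, ∀ t ∈ Set.Icc a b, dist (Q s) (Q t) ≤ M := by
    obtain ⟨M, hM⟩ := Metric.isBounded_iff.1
      (isCompact_Icc.image hQ : IsCompact (Q '' Set.Icc a b)).isBounded
    exact ⟨M, fun s hs t ht => hM ⟨s, hs, rfl⟩ ⟨t, ht, rfl⟩⟩
  refine ⟨max (Real.sqrt (2 * C₂)) (M / h₀), fun s t has hst htb => ?_⟩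
  rcases hst.eq_or_lt with rfl | hlt
  · simp
  by_cases hcase : t - s ≤ h₀
  · have hw := hshort (t - s) ⟨by linarith, hcase⟩ s has (hst.trans htb)
    simp only [hWdef, add_sub_cancel] at hw
    have : dist (Q s) (Q t) ≤ Real.sqrt (2 * C₂) * (t - s) := by
      refine abs_le_of_sq_le_sq' ?_ (by have := sub_pos.2 hlt; positivity) |>.2
      rw [mul_pow, Real.sq_sqrt (by positivity)]
      linarith
    exact this.trans (mul_le_mul_of_nonneg_right (le_max_left _ _) (by linarith))
  · have hm := hM s ⟨has, hst.trans htb⟩ t ⟨has.trans hst, htb⟩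
    have hM0 : 0 ≤ M := dist_nonneg.trans hm
    have : M ≤ M / h₀ * (t - s) := by
      rw [div_mul_eq_mul_div, le_div_iff₀ hh₀]
      exact mul_le_mul_of_nonneg_left (by linarith) hM0
    exact (hm.trans this).trans (mul_le_mul_of_nonneg_right (le_max_right _ _) (by linarith))

theorem absolutelyContinuousOnInterval_dist_of_le_integral {X : Type*} [PseudoMetricSpace X]
    {P : ℝ → X} {g : ℝ → ℝ} {a b : ℝ} (hab : a ≤ b) (hg : IntegrableOn g (Set.Icc a b))
    (h : ∀ s t : ℝ, a ≤ s → s ≤ t → t ≤ b → dist (P s) (P t) ≤ ∫ u in s..t, g u) (R : X) :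
    AbsolutelyContinuousOnInterval (fun u => dist (P u) R) a b := by
  have hgi : IntervalIntegrable g volume a b :=
    (intervalIntegrable_iff_integrableOn_Icc_of_le hab).2 hg
  refine absolutelyContinuousOnInterval_of_dist_le
    (hgi.absolutelyContinuousOnInterval_intervalIntegral (c := a) (by simp)) ?_
  have key : ∀ x ∈ Set.uIcc a b, ∀ y ∈ Set.uIcc a b, x ≤ y → dist (dist (P x) R) (dist (P y) R) ≤
      dist (∫ v in a..x, g v) (∫ v in a..y, g v) := by
    intro x hx y hy hxy
    have hx' := hx
    have hy' := hy
    rw [Set.uIcc_of_le hab] at hx hy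
    refine (dist_dist_dist_le_left (P x) (P y) R).trans ((h x y hx.1 hxy hy.2).trans ?_)
    rw [← intervalIntegral.integral_interval_sub_left (a := a)
      (hgi.mono_set (Set.uIcc_subset_uIcc Set.left_mem_uIcc hy'))
      (hgi.mono_set (Set.uIcc_subset_uIcc Set.left_mem_uIcc hx')), dist_comm]
    exact le_abs_self _
  intro x hx y hy
  rcases le_total x y with hxy | hxy
  · exact key x hx y hy hxy
  · rw [dist_comm, dist_comm (∫ v in a..x, g v)]
    exact key y hy x hx hxy

theorem ae_differentiableAt_dist {X : Type*} [PseudoMetricSpace X] {P : ℝ → X}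
    (h : ∀ a b : ℝ, 0 < a → a ≤ b → ∃ g : ℝ → ℝ, IntegrableOn g (Set.Icc a b) ∧
      ∀ s t : ℝ, a ≤ s → s ≤ t → t ≤ b → dist (P s) (P t) ≤ ∫ u in s..t, g u) (R : X) :
    ∀ᵐ t, 0 < t → DifferentiableAt ℝ (fun u => dist (P u) R) t := by
  have h1 : ∀ n : ℕ, ∀ᵐ t, t ∈ Set.uIcc (1 / ((n : ℝ) + 1)) (n + 1) →
      DifferentiableAt ℝ (fun u => dist (P u) R) t := by
    intro n
    have hn : 1 / ((n : ℝ) + 1) ≤ n + 1 := by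
      rw [div_le_iff₀ (by positivity)]
      nlinarith [(Nat.cast_nonneg n : (0:ℝ) ≤ n)]
    obtain ⟨g, hg, hgP⟩ := h _ _ (by positivity) hn
    exact (absolutelyContinuousOnInterval_dist_of_le_integral hn hg hgP R).ae_differentiableAt
  filter_upwards [ae_all_iff.2 h1] with t ht ht0
  obtain ⟨n₁, h₁⟩ := exists_nat_one_div_lt ht0
  obtain ⟨n₂, h₂⟩ := exists_nat_gt t
  refine ht (max n₁ n₂) (Set.mem_uIcc_of_le ?_ ?_)
  · refine le_trans ?_ h₁.le
    refine one_div_le_one_div_of_le (by positivity) ?_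
    push_cast
    linarith [le_max_left (n₁ : ℝ) n₂]
  · push_cast
    linarith [le_max_right (n₁ : ℝ) n₂]

theorem ae_hasDerivAt_primitive {χ : ℝ → ℝ} (hχ : ∀ a b, IntervalIntegrable χ volume a b) :
    ∀ᵐ t, HasDerivAt (fun x => ∫ u in (0:ℝ)..x, χ u) (χ t) t := by
  have h1 : ∀ n : ℕ, ∀ᵐ t, t ∈ Set.uIcc (-(n : ℝ)) n →
      ∀ c ∈ Set.uIcc (-(n : ℝ)) n, HasDerivAt (fun x => ∫ u in c..x, χ u) (χ t) t :=
    fun n => (hχ _ _).ae_hasDerivAt_integral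
  filter_upwards [ae_all_iff.2 h1] with t ht
  obtain ⟨n, hn⟩ := exists_nat_ge |t|
  refine ht n (Set.mem_uIcc_of_le ?_ ?_) 0 (Set.mem_uIcc_of_le ?_ ?_)
  · linarith [neg_abs_le t]
  · linarith [le_abs_self t]
  · simp
  · simp

theorem integral_add_sub_le_of_deriv_add_le {v η ℓ χ : ℝ → ℝ} {a b : ℝ} (hab : a ≤ b)
    (hv : AbsolutelyContinuousOnInterval v a b) (hη : Measurable η)
    (hℓ : IntervalIntegrable ℓ volume a b) (hχ : IntervalIntegrable χ volume a b)
    (hℓη : ∀ u, ℓ u ≤ η u) (h : ∀ᵐ u, u ∈ Set.Ioc a b → deriv v u + η u ≤ χ u) :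
    IntervalIntegrable η volume a b ∧ (∫ u in a..b, η u) + (v b - v a) ≤ ∫ u in a..b, χ u := by
  have hd := hv.intervalIntegrable_deriv
  have hη' : IntervalIntegrable η volume a b := by
    rw [intervalIntegrable_iff_integrableOn_Ioc_of_le hab] at *
    refine integrable_of_le_of_le hη.aestronglyMeasurable (ae_of_all _ hℓη) ?_ hℓ (hχ.sub hd)
    refine (ae_restrict_iff' measurableSet_Ioc).2 ?_
    filter_upwards [h] with u hu hu'
    have := hu hu'
    simp only [Pi.sub_apply]
    linarith
  refine ⟨hη', ?_⟩
  rw [← hv.integral_deriv_eq_sub, ← intervalIntegral.integral_add hη' hd]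
  refine intervalIntegral.integral_mono_ae_restrict hab (hη'.add hd) hχ ?_
  rw [Filter.EventuallyLE, ← restrict_Ioc_eq_restrict_Icc, ae_restrict_iff' measurableSet_Ioc]
  filter_upwards [h] with u hu hu'
  linarith [hu hu']

theorem integral_add_sub_le_of_forall_pos {v η ℓ χ : ℝ → ℝ} {t : ℝ} (ht : 0 < t)
    (hv : Continuous v) (hℓ : Continuous ℓ) (hχ : Continuous χ) (hℓη : ∀ u, ℓ u ≤ η u)
    (h : ∀ a, 0 < a → a ≤ t → IntervalIntegrable η volume a t ∧
      (∫ u in a..t, η u) + (v t - v a) ≤ ∫ u in a..t, χ u) :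
    IntervalIntegrable η volume 0 t ∧
      (∫ u in (0:ℝ)..t, η u) + (v t - v 0) ≤ ∫ u in (0:ℝ)..t, χ u := by
  have hη' : IntervalIntegrable η volume 0 t := by
    let c : ℝ → ℝ := fun a => (∫ u in a..t, (χ u - ℓ u)) - (v t - v a)
    have hc : Continuous c := by
      have hcont : Continuous fun a => ∫ u in a..t, (χ u - ℓ u) := by
        simp_rw [intervalIntegral.integral_symm t]
        exact (intervalIntegral.continuous_primitive
          (fun x y => (hχ.sub hℓ).intervalIntegrable x y) t).neg
      fun_prop
    obtain ⟨M, hM⟩ := (isCompact_Icc (a := (0:ℝ)) (b := t)).bddAbove_image hc.continuousOn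
    have hs : ∀ n : ℕ, 0 < t / ((n : ℝ) + 1) ∧ t / ((n : ℝ) + 1) ≤ t := fun n =>
      ⟨by positivity, div_le_self ht.le (by simp)⟩
    have hlim : Tendsto (fun n : ℕ => t / ((n : ℝ) + 1)) atTop (𝓝 0) :=
      by simpa [div_eq_mul_inv] using tendsto_one_div_add_atTop_nhds_zero_nat.const_mul t
    have hi : ∀ n : ℕ, IntervalIntegrable (fun u => η u - ℓ u) volume (t / ((n : ℝ) + 1)) t :=
      fun n => (h _ (hs n).1 (hs n).2).1.sub (hℓ.intervalIntegrable _ _)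
    have hsub : IntervalIntegrable (fun u => η u - ℓ u) volume 0 t := by
      rw [intervalIntegrable_iff_integrableOn_Ioc_of_le ht.le]
      refine integrableOn_Ioc_of_intervalIntegral_norm_bounded_left (I := M)
        (fun n => (intervalIntegrable_iff_integrableOn_Ioc_of_le (hs n).2).1 (hi n)) hlim
        (Eventually.of_forall fun n => ?_)
      rw [← intervalIntegral.integral_of_le (hs n).2]
      have hn : ∀ u, ‖η u - ℓ u‖ = η u - ℓ u := fun u =>
        Real.norm_of_nonneg (sub_nonneg.2 (hℓη u))
      simp_rw [hn]
      have h1 := h _ (hs n).1 (hs n).2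
      have h2 := hM ⟨_, ⟨(hs n).1.le, (hs n).2⟩, rfl⟩
      simp only [c] at h2
      rw [intervalIntegral.integral_sub (hχ.intervalIntegrable _ _)
        (hℓ.intervalIntegrable _ _)] at h2
      rw [intervalIntegral.integral_sub h1.1 (hℓ.intervalIntegrable _ _)]
      linarith [h1.2]
    simpa using hsub.add (hℓ.intervalIntegrable (μ := volume) 0 t)
  refine ⟨hη', ?_⟩
  have hprim : ∀ f : ℝ → ℝ, IntervalIntegrable f volume 0 t →
      Tendsto (fun a => ∫ u in a..t, f u) (𝓝[>] 0) (𝓝 (∫ u in (0:ℝ)..t, f u)) := by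
    intro f hf
    have hcw := (intervalIntegral.continuousOn_primitive_interval_left
      ((intervalIntegrable_iff' (by simp)).1 hf)) 0 Set.left_mem_uIcc
    refine hcw.tendsto.mono_left ?_
    rw [Set.uIcc_of_le ht.le, ← nhdsWithin_Ioc_eq_nhdsGT ht]
    exact nhdsWithin_mono _ Set.Ioc_subset_Icc_self
  have hvt : Tendsto v (𝓝[>] 0) (𝓝 (v 0)) := (hv.tendsto 0).mono_left nhdsWithin_le_nhds
  refine le_of_tendsto_of_tendsto ((hprim η hη').add (hvt.const_sub (v t)))
    (hprim χ (hχ.intervalIntegrable _ _)) ?_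
  filter_upwards [Ioc_mem_nhdsGT ht] with a ha
  exact (h a ha.1 ha.2).2

theorem erealIntegral_exp_mul_add_le_iff {K : ℝ} {φ : ℝ → EReal} (hφ : ∀ u, φ u ≠ ⊥)
    {s t c d : ℝ} (hst : s ≤ t) :
    erealIntegral (fun u => ((Real.exp (K * u) : ℝ) : EReal) * φ u) s t + (c : EReal) ≤ (d : EReal)
      ↔ (∀ᵐ u, u ∈ Set.Ioc s t → φ u ≠ ⊤) ∧
        IntervalIntegrable (fun u => Real.exp (K * u) * (φ u).toReal) volume s t ∧
        (∫ u in s..t, Real.exp (K * u) * (φ u).toReal) + c ≤ d := by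
  have htop : ∀ u, ((Real.exp (K * u) : ℝ) : EReal) * φ u ≠ ⊤ ↔ φ u ≠ ⊤ := by
    intro u
    by_cases hu : φ u = ⊤
    · simp [hu, EReal.coe_mul_top_of_pos (Real.exp_pos _)]
    · lift φ u to ℝ using ⟨hu, hφ u⟩ with r
      simp [← EReal.coe_mul]
  unfold erealIntegral
  simp only [htop, EReal.toReal_mul, EReal.toReal_coe]
  rw [ae_restrict_iff' measurableSet_Ioc, intervalIntegrable_iff_integrableOn_Ioc_of_le hst,
    intervalIntegral.integral_of_le hst]
  split_ifs with h
  · rw [← EReal.coe_add, EReal.coe_le_coe_iff]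
    tauto
  · rw [EReal.top_add_coe, top_le_iff]
    simp only [EReal.coe_ne_top, false_iff]
    tauto

/-- A locally absolutely continuous curve satisfying the differential `EVI(K)` at a point `R` with
`F R` finite satisfies the integral `EVI(K)` at `R`. -/
theorem integral_evi_of_differential_evi {X : Type*} [MetricSpace X] {K : ℝ} {F : X → EReal} {m : ℝ}
    (hm : ∀ x, (m : EReal) ≤ F x) (hm0 : m ≤ 0)
    {P : ℝ → X} (hPcont : ContinuousOn P (Set.Ici 0))
    (hFmeas : Measurable ((Set.Ici (0 : ℝ)).restrict fun t => F (P t)))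
    (hac : ∀ a b : ℝ, 0 < a → a ≤ b → ∃ g : ℝ → ℝ, IntegrableOn g (Set.Icc a b) ∧
      ∀ s t : ℝ, a ≤ s → s ≤ t → t ≤ b → dist (P s) (P t) ≤ ∫ u in s..t, g u)
    {R : X} {f : ℝ}
    (hevi : ∀ᵐ t, 0 < t → ∃ D : ℝ, HasDerivAt (fun u => dist (P u) R ^ 2 / 2) D t ∧
      ((D + K / 2 * dist (P t) R ^ 2 : ℝ) : EReal) + F (P t) ≤ (f : EReal))
    {s t : ℝ} (hs : 0 ≤ s) (hst : s < t) :
    (∀ᵐ u, u ∈ Set.Ioc s t → F (P u) ≠ ⊤) ∧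
      IntervalIntegrable (fun u => Real.exp (K * u) * (F (P u)).toReal) volume s t ∧
      (∫ u in s..t, Real.exp (K * u) * (F (P u)).toReal) +
        (Real.exp (K * t) * dist (P t) R ^ 2 / 2 - Real.exp (K * s) * dist (P s) R ^ 2 / 2) ≤
        (∫ u in s..t, Real.exp (K * u)) * f := by
  have hbot : ∀ x, F x ≠ ⊥ := fun x hx => by simpa [hx] using hm x
  set Q : ℝ → X := fun u => P (max u 0) with hQdef
  have hQP : ∀ u, 0 ≤ u → Q u = P u := fun u hu => by simp [hQdef, hu]
  have hQ : Continuous Q := hPcont.comp_continuous (by fun_prop) fun u =>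
    Set.mem_Ici.2 (le_max_right _ _)
  have hFQ : Measurable fun u => F (Q u) :=
    hFmeas.comp (g := Set.Ici (0:ℝ) |>.restrict fun t => F (P t))
      (f := fun u : ℝ => (⟨max u 0, Set.mem_Ici.2 (le_max_right _ _)⟩ : Set.Ici (0:ℝ)))
      (Measurable.subtype_mk (by fun_prop))
  have hreal : ∀ᵐ u, 0 < u → F (P u) ≠ ⊤ ∧ ∃ D : ℝ,
      HasDerivAt (fun u => dist (P u) R ^ 2 / 2) D u ∧
      D + K / 2 * dist (P u) R ^ 2 + (F (P u)).toReal ≤ f := by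
    filter_upwards [hevi] with u hu hu0
    obtain ⟨D, hD, hle⟩ := hu hu0
    have htop : F (P u) ≠ ⊤ := by
      intro h
      rw [h, EReal.coe_add_top, top_le_iff] at hle
      exact EReal.coe_ne_top _ hle
    refine ⟨htop, D, hD, ?_⟩
    rw [← EReal.coe_toReal htop (hbot _)] at hle
    exact_mod_cast hle
  refine ⟨hreal.mono fun u hu hI => (hu (hs.trans_lt hI.1)).1, ?_⟩
  set η : ℝ → ℝ := fun u => Real.exp (K * u) * (F (Q u)).toReal with hηdef
  have hη : Measurable η := by
    have := hFQ.ereal_toReal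
    fun_prop
  set v : ℝ → ℝ := fun u => Real.exp (K * u) * dist (Q u) R ^ 2 / 2 with hvdef
  have hv : Continuous v := by fun_prop
  set ℓ : ℝ → ℝ := fun u => Real.exp (K * u) * m with hℓdef
  have hℓ : Continuous ℓ := by fun_prop
  set χ : ℝ → ℝ := fun u => Real.exp (K * u) * f with hχdef
  have hχ : Continuous χ := by fun_prop
  have hℓη : ∀ u, ℓ u ≤ η u := by
    intro u
    refine mul_le_mul_of_nonneg_left ?_ (Real.exp_pos _).le
    by_cases h : F (Q u) = ⊤
    · simpa [h] using hm0
    · have := hm (Q u)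
      rw [← EReal.coe_toReal h (hbot _)] at this
      exact_mod_cast this
  have hpos : ∀ a b, 0 < a → a ≤ b → IntervalIntegrable η volume a b ∧
      (∫ u in a..b, η u) + (v b - v a) ≤ ∫ u in a..b, χ u := by
    intro a b ha hab
    obtain ⟨g, hg, hgP⟩ := hac a b ha hab
    have hgQ : ∀ s t : ℝ, a ≤ s → s ≤ t → t ≤ b → dist (Q s) (Q t) ≤ ∫ u in s..t, g u := by
      intro s t has hst htb
      rw [hQP s (by linarith), hQP t (by linarith)]
      exact hgP s t has hst htb
    have hd := absolutelyContinuousOnInterval_dist_of_le_integral hab hg hgQ R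
    have he : AbsolutelyContinuousOnInterval (fun u => Real.exp (K * u) / 2) a b :=
      ContDiffOn.absolutelyContinuousOnInterval (by fun_prop)
    have hvac : AbsolutelyContinuousOnInterval v a b := by
      convert he.fun_mul (hd.fun_mul hd) using 2
      ring
    refine integral_add_sub_le_of_deriv_add_le hab hvac hη (hℓ.intervalIntegrable _ _)
      (hχ.intervalIntegrable _ _) hℓη ?_
    filter_upwards [hreal] with u hu huI
    have hu0 : 0 < u := ha.trans huI.1
    obtain ⟨-, D, hD, hle⟩ := hu hu0
    have hexp : HasDerivAt (fun u => Real.exp (K * u)) (Real.exp (K * u) * K) u := by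
      simpa using ((hasDerivAt_id u).const_mul K).exp
    have hvd : HasDerivAt v (Real.exp (K * u) * K * (dist (P u) R ^ 2 / 2) +
        Real.exp (K * u) * D) u := by
      refine (hexp.fun_mul hD).congr_of_eventuallyEq ?_
      filter_upwards [lt_mem_nhds hu0] with x hx
      simp only [hvdef, hQP x hx.le]
      ring
    rw [hvd.deriv]
    simp only [hηdef, hχdef, hQP u hu0.le]
    nlinarith [mul_le_mul_of_nonneg_left hle (Real.exp_pos (K * u)).le]
  have hmain : IntervalIntegrable η volume s t ∧
      (∫ u in s..t, η u) + (v t - v s) ≤ ∫ u in s..t, χ u := by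
    rcases hs.eq_or_lt with rfl | hs
    · exact integral_add_sub_le_of_forall_pos hst hv hℓ hχ hℓη fun a ha hat => hpos a t ha hat
    · exact hpos s t hs hst.le
  have hEq : Set.EqOn (fun u => Real.exp (K * u) * (F (P u)).toReal) η (Set.uIcc s t) := by
    intro u hu
    rw [Set.uIcc_of_le hst.le] at hu
    simp only [hηdef, hQP u (hs.trans hu.1)]
  rw [intervalIntegral.integral_congr hEq]
  refine ⟨hmain.1.congr fun u hu => (hEq (Set.uIoc_subset_uIcc hu)).symm, ?_⟩
  have := hmain.2
  simp only [hvdef, hχdef, hQP s hs, hQP t (hs.trans hst.le)] at this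
  rwa [intervalIntegral.integral_mul_const] at this

/-- The integral `EVI(K)`, tested against the points of the domain of `F`, implies local absolute
continuity and the differential `EVI(K)`. -/
theorem differential_evi_of_integral_evi {X : Type*} [MetricSpace X] {K : ℝ} {F : X → EReal} {m : ℝ}
    (hm : ∀ x, (m : EReal) ≤ F x) (hm0 : m ≤ 0)
    {P : ℝ → X} (hPcont : ContinuousOn P (Set.Ici 0)) (hF0 : F (P 0) ≠ ⊤)
    (hint : ∀ R : X, F R ≠ ⊤ → ∀ s t : ℝ, 0 ≤ s → s < t →
      (∀ᵐ u, u ∈ Set.Ioc s t → F (P u) ≠ ⊤) ∧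
      IntervalIntegrable (fun u => Real.exp (K * u) * (F (P u)).toReal) volume s t ∧
      (∫ u in s..t, Real.exp (K * u) * (F (P u)).toReal) +
        (Real.exp (K * t) * dist (P t) R ^ 2 / 2 - Real.exp (K * s) * dist (P s) R ^ 2 / 2) ≤
        (∫ u in s..t, Real.exp (K * u)) * (F R).toReal) :
    (∀ a b : ℝ, 0 < a → a ≤ b → ∃ g : ℝ → ℝ, IntegrableOn g (Set.Icc a b) ∧
      ∀ s t : ℝ, a ≤ s → s ≤ t → t ≤ b → dist (P s) (P t) ≤ ∫ u in s..t, g u) ∧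
    ∀ R : X, ∀ᵐ t, 0 < t → ∃ D : ℝ, HasDerivAt (fun u => dist (P u) R ^ 2 / 2) D t ∧
      ((D + K / 2 * dist (P t) R ^ 2 : ℝ) : EReal) + F (P t) ≤ F R := by
  have hbot : ∀ x, F x ≠ ⊥ := fun x hx => by simpa [hx] using hm x
  set Q : ℝ → X := fun u => P (max u 0) with hQdef
  have hQP : ∀ u, 0 ≤ u → Q u = P u := fun u hu => by simp [hQdef, hu]
  have hQ : Continuous Q := hPcont.comp_continuous (by fun_prop) fun u =>
    Set.mem_Ici.2 (le_max_right _ _)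
  have hfin : ∀ᵐ u, F (Q u) ≠ ⊤ := by
    have h1 : ∀ n : ℕ, ∀ᵐ u, u ∈ Set.Ioc (0:ℝ) ((n : ℝ) + 1) → F (P u) ≠ ⊤ := fun n =>
      (hint (P 0) hF0 0 _ le_rfl (by positivity)).1
    filter_upwards [ae_all_iff.2 h1] with u hu
    rcases le_or_gt u 0 with h | h
    · simpa [hQdef, h] using hF0
    · rw [hQP u h.le]
      obtain ⟨n, hn⟩ := exists_nat_gt u
      exact hu n ⟨h, by linarith⟩
  set ψ : ℝ → ℝ := fun u => (F (Q u)).toReal - m with hψdef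
  have hψ0 : ∀ u, 0 ≤ ψ u := by
    intro u
    refine sub_nonneg.2 ?_
    by_cases h : F (Q u) = ⊤
    · simpa [h] using hm0
    · have := hm (Q u)
      rw [← EReal.coe_toReal h (hbot _)] at this
      exact_mod_cast this
  have hψint : ∀ a b, IntervalIntegrable ψ volume a b := by
    have h0 : ∀ x, IntervalIntegrable ψ volume 0 x := by
      intro x
      rcases lt_or_ge 0 x with hx | hx
      · have h1 := ((hint (P 0) hF0 0 x le_rfl hx).2.1.continuousOn_mul
          (g := fun u => Real.exp (-(K * u))) (by fun_prop)).sub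
          (intervalIntegrable_const (c := m))
        refine h1.congr fun u hu => ?_
        rw [Set.uIoc_of_le hx.le] at hu
        simp only [hψdef, hQP u hu.1.le, ← mul_assoc, ← Real.exp_add]
        simp
      · refine (intervalIntegrable_const (c := ψ 0)).congr fun u hu => ?_
        rw [Set.uIoc_of_ge hx] at hu
        simp [hψdef, hQdef, hu.2]
    exact fun a b => (h0 a).symm.trans (h0 b)
  have hreal : ∀ R : X, F R ≠ ⊤ → ∀ s t : ℝ, 0 ≤ s → s < t →
      Real.exp (K * t) * (dist (Q t) R ^ 2 / 2) - Real.exp (K * s) * (dist (Q s) R ^ 2 / 2) ≤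
        ∫ u in s..t, Real.exp (K * u) * ((F R).toReal - m - ψ u) := by
    intro R hR s t hs hst
    obtain ⟨-, h1, h2⟩ := hint R hR s t hs hst
    rw [← intervalIntegral.integral_mul_const, ← le_sub_iff_add_le',
      ← intervalIntegral.integral_sub (Continuous.intervalIntegrable (by fun_prop) _ _) h1] at h2
    rw [hQP s hs, hQP t (hs.trans hst.le), ← mul_div_assoc, ← mul_div_assoc]
    refine h2.trans_eq (intervalIntegral.integral_congr fun u hu => ?_)
    rw [Set.uIcc_of_le hst.le] at hu
    simp only [hψdef, hQP u (hs.trans hu.1)]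
    ring
  have star : ∀ x ∈ {x | F (Q x) ≠ ⊤}, ∀ s, 0 ≤ s → ∀ ε, 0 < ε →
      (1 - |K| * ε) * (dist (Q (s + ε)) (Q x) ^ 2 / 2) - dist (Q s) (Q x) ^ 2 / 2 ≤
        ε * Real.exp (|K| * ε) * ψ x - Real.exp (-(|K| * ε)) * ∫ u in s..(s + ε), ψ u := by
    intro x hx s hs ε hε
    have h1 := mul_le_mul_of_nonneg_left (hreal (Q x) hx s (s + ε) hs (by linarith))
      (Real.exp_pos (-(K * s))).le
    have hKabs : ∀ y ∈ Set.Icc s (s + ε), -(|K| * ε) ≤ -(K * s) + K * y ∧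
        -(K * s) + K * y ≤ |K| * ε := by
      intro y hy
      have : |K * (y - s)| ≤ |K| * ε := by
        rw [abs_mul]
        exact mul_le_mul_of_nonneg_left (abs_le.2 ⟨by linarith [hy.1], by linarith [hy.2]⟩)
          (abs_nonneg K)
      have := abs_le.1 this
      constructor <;> linarith [this.1, this.2]
    rw [← intervalIntegral.integral_const_mul, mul_sub, ← mul_assoc, ← mul_assoc, ← Real.exp_add,
      ← Real.exp_add, neg_add_cancel, Real.exp_zero, one_mul] at h1
    have h2 : (1 - |K| * ε) * (dist (Q (s + ε)) (Q x) ^ 2 / 2) ≤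
        Real.exp (-(K * s) + K * (s + ε)) * (dist (Q (s + ε)) (Q x) ^ 2 / 2) := by
      refine mul_le_mul_of_nonneg_right ?_ (by positivity)
      exact (Real.one_sub_le_exp_neg _).trans
        (Real.exp_le_exp.2 (hKabs _ (Set.right_mem_Icc.2 (by linarith))).1)
    have h3 : ∫ u in s..(s + ε), Real.exp (-(K * s)) *
          (Real.exp (K * u) * ((F (Q x)).toReal - m - ψ u)) ≤
        ∫ u in s..(s + ε), (Real.exp (|K| * ε) * ψ x - Real.exp (-(|K| * ε)) * ψ u) := by
      refine intervalIntegral.integral_mono_on (by linarith) ?_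
        (intervalIntegrable_const.sub ((hψint _ _).const_mul _)) fun u hu => ?_
      · exact ((intervalIntegrable_const.sub (hψint _ _)).continuousOn_mul
          (by fun_prop)).const_mul _
      · rw [← mul_assoc, ← Real.exp_add]
        have e1 := mul_le_mul_of_nonneg_right (Real.exp_le_exp.2 (hKabs u hu).2) (hψ0 x)
        have e2 := mul_le_mul_of_nonneg_right (Real.exp_le_exp.2 (hKabs u hu).1) (hψ0 u)
        have e3 : (F (Q x)).toReal - m = ψ x := rfl
        rw [e3]
        linarith
    have h4 : ∫ u in s..(s + ε), (Real.exp (|K| * ε) * ψ x - Real.exp (-(|K| * ε)) * ψ u) =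
        ε * Real.exp (|K| * ε) * ψ x - Real.exp (-(|K| * ε)) * ∫ u in s..(s + ε), ψ u := by
      rw [intervalIntegral.integral_sub intervalIntegrable_const ((hψint _ _).const_mul _),
        intervalIntegral.integral_const, intervalIntegral.integral_const_mul, smul_eq_mul,
        add_sub_cancel_left, mul_assoc]
    linarith
  have hac : ∀ a b : ℝ, 0 < a → a ≤ b → ∃ g : ℝ → ℝ, IntegrableOn g (Set.Icc a b) ∧
      ∀ s t : ℝ, a ≤ s → s ≤ t → t ≤ b → dist (P s) (P t) ≤ ∫ u in s..t, g u := by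
    intro a b ha hab
    obtain ⟨C, hC⟩ := exists_forall_dist_le_mul_sub hQ hψ0 hψint hfin star (abs_nonneg K)
      (b := b) ha
    refine ⟨fun _ => C, continuous_const.integrableOn_Icc, fun s t has hst htb => ?_⟩
    have := hC s t has hst htb
    rw [hQP s (by linarith), hQP t (by linarith)] at this
    rw [intervalIntegral.integral_const, smul_eq_mul]
    linarith
  refine ⟨hac, fun R => ?_⟩
  have hdiff : ∀ᵐ t, 0 < t → ∃ D : ℝ, HasDerivAt (fun u => dist (P u) R ^ 2 / 2) D t := by
    filter_upwards [ae_differentiableAt_dist hac R] with t ht ht0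
    exact ⟨_, (((ht ht0).fun_pow 2).div_const 2).hasDerivAt⟩
  by_cases hR : F R = ⊤
  · filter_upwards [hdiff] with t ht ht0
    obtain ⟨D, hD⟩ := ht ht0
    exact ⟨D, hD, hR ▸ le_top⟩
  set χ : ℝ → ℝ := fun u => Real.exp (K * u) * ((F R).toReal - m - ψ u) with hχdef
  have hχ : ∀ a b, IntervalIntegrable χ volume a b := fun a b =>
    (intervalIntegrable_const.sub (hψint _ _)).continuousOn_mul (by fun_prop)
  filter_upwards [hdiff, ae_hasDerivAt_primitive hχ, hfin] with t ht hprim htop ht0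
  obtain ⟨D, hD⟩ := ht ht0
  refine ⟨D, hD, ?_⟩
  have hexp : HasDerivAt (fun u => Real.exp (K * u)) (Real.exp (K * t) * K) t := by
    simpa using ((hasDerivAt_id t).const_mul K).exp
  have hle := ((hexp.fun_mul hD).sub hprim).nonpos_of_eventually_le_right (by
    filter_upwards [self_mem_nhdsWithin] with ε hε
    have hε : 0 < ε := hε
    have h1 := hreal R hR t (t + ε) ht0.le (by linarith)
    rw [hQP t ht0.le, hQP (t + ε) (by linarith)] at h1
    have h2 := intervalIntegral.integral_interval_sub_left (hχ 0 (t + ε)) (hχ 0 t)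
    simp only [Pi.sub_apply]
    linarith)
  simp only [hχdef, hψdef, hQP t ht0.le] at hle htop
  have hle' : Real.exp (K * t) * (D + K / 2 * dist (P t) R ^ 2 + (F (P t)).toReal - (F R).toReal)
      ≤ 0 := by linarith
  have := nonpos_of_mul_nonpos_right hle' (Real.exp_pos _)
  rw [← EReal.coe_toReal htop (hbot _), ← EReal.coe_toReal hR (hbot _)]
  exact_mod_cast sub_nonpos.1 this

/-- Equivalence of the differential and the integral formulations of the Evolution
Variational Inequality `EVI(K)` for a curve `P` on `[0,∞)` in a metric space `X`, with
respect to a functional `F : X → ℝ ∪ {+∞}` bounded from below. -/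
theorem stmt16 {X : Type*} [MetricSpace X] (K : ℝ) (F : X → EReal)
    (hFbd : ∃ m : ℝ, ∀ x, (m : EReal) ≤ F x)
    (P : ℝ → X) (hPcont : ContinuousOn P (Set.Ici 0))
    (hF0 : F (P 0) ≠ ⊤)
    (hFmeas : Measurable ((Set.Ici (0 : ℝ)).restrict fun t => F (P t))) :
    (((∀ a b : ℝ, 0 < a → a ≤ b →
        ∃ g : ℝ → ℝ, IntegrableOn g (Set.Icc a b) ∧
          ∀ s t : ℝ, a ≤ s → s ≤ t → t ≤ b →
            dist (P s) (P t) ≤ ∫ u in s..t, g u) ∧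
      (∀ R : X, ∀ᵐ t ∂(volume.restrict (Set.Ioi (0 : ℝ))),
          ∃ D : ℝ, HasDerivAt (fun u => dist (P u) R ^ 2 / 2) D t ∧
            ((D + K / 2 * dist (P t) R ^ 2 : ℝ) : EReal) + F (P t) ≤ F R))
    ↔
    (∀ R : X, ∀ s t : ℝ, 0 ≤ s → s < t →
        erealIntegral (fun u => ((Real.exp (K * u) : ℝ) : EReal) * F (P u)) s t
          + ((Real.exp (K * t) * dist (P t) R ^ 2 / 2
              - Real.exp (K * s) * dist (P s) R ^ 2 / 2 : ℝ) : EReal)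
          ≤ (((∫ u in s..t, Real.exp (K * u)) : ℝ) : EReal) * F R)) := by
  obtain ⟨m, hm, hm0⟩ : ∃ m : ℝ, (∀ x, (m : EReal) ≤ F x) ∧ m ≤ 0 := by
    obtain ⟨m, hm⟩ := hFbd
    exact ⟨min m 0, fun x => (EReal.coe_le_coe_iff.2 (min_le_left _ _)).trans (hm x),
      min_le_right _ _⟩
  have hbot : ∀ x, F x ≠ ⊥ := fun x hx => by simpa [hx] using hm x
  simp_rw [ae_restrict_iff' measurableSet_Ioi, Set.mem_Ioi]
  constructor
  · rintro ⟨hac, hevi⟩ R s t hs hst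
    by_cases hR : F R = ⊤
    · have hpos : 0 < ∫ u in s..t, Real.exp (K * u) :=
        intervalIntegral.intervalIntegral_pos_of_pos
          (Continuous.intervalIntegrable (by fun_prop) _ _) (fun u => Real.exp_pos _) hst
      rw [hR, EReal.coe_mul_top_of_pos hpos]
      exact le_top
    · have hevi := hevi R
      rw [← EReal.coe_toReal hR (hbot R)] at hevi ⊢
      rw [← EReal.coe_mul, erealIntegral_exp_mul_add_le_iff (fun u => hbot _) hst.le]
      exact integral_evi_of_differential_evi hm hm0 hPcont hFmeas hac hevi hs hst
  · intro H
    refine differential_evi_of_integral_evi hm hm0 hPcont hF0 fun R hR s t hs hst => ?_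
    have h := H R s t hs hst
    rwa [← EReal.coe_toReal hR (hbot R), ← EReal.coe_mul,
      erealIntegral_exp_mul_add_le_iff (fun u => hbot _) hst.le] at h
end
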